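/- Let a, b > 0 with a − 2b > 0 and set c₀ = √(2b/(9a(a−b))) · 80b²/(81a). Let η ∈ (0, √(a−b) − √(a/2)), φ_η an admissible cutoff, x ∈ (0,1), R > 0, and k ∈ ℕ. Suppose that (i) H(f_{x,η}, g_{x,η})(R) < c₀/R; (ii) either g_{x,η}(R) ∈ (0, √(2b/a)) and f_{x,η}(R) < 0, or g_{x,η}(R) ∈ (−√(2b/a), 0) and f_{x,η}(R) > 0; and (iii) g_{x,η} changes sign exactly k times on (0, R]. Then x ∈ A_k ∪ I_k ∪ A_{k+1}. -/

import Mathlib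

open Real Set Filter Topology

noncomputable section

/-- The Hamiltonian energy `H(f,g) = ½ f²(1−g²) + (a/4) g⁴ − (b/2) g²`. -/
def Ham (a b f g : ℝ) : ℝ := 1 / 2 * f ^ 2 * (1 - g ^ 2) + a / 4 * g ^ 4 - b / 2 * g ^ 2

/-- The set `𝒜` of admissible points. -/
def Aadm (a b : ℝ) : Set (ℝ × ℝ) :=
  {p | 2 * p.1 ^ 2 - a * p.2 ^ 2 - (a - 2 * b) ≤ 0 ∧ p.2 ^ 2 ≤ 1}

/-- `φ` is an admissible cutoff function `φ_η`. -/
def IsCutoff (a b η : ℝ) (φ : ℝ → ℝ → ℝ) : Prop :=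
  (∀ f g, φ f g ∈ Icc (0 : ℝ) 1) ∧
  ContDiffOn ℝ (⊤ : ℕ∞) (fun p : ℝ × ℝ => φ p.1 p.2)
    (Ioo (-Real.sqrt (a - b)) (Real.sqrt (a - b)) ×ˢ (univ : Set ℝ)) ∧
  (∀ f g, φ f g = φ |f| |g|) ∧
  (∀ f g, Real.sqrt (a - b) - η / 2 ≤ |f| → φ f g = 0) ∧
  (∀ f g, |f| ≤ Real.sqrt (a - b) - η → φ f g = 1)

/-- `(f, g)` is a `C¹` solution on `s` of the original Cauchy problem
`f' + (2/r) f = g(f² − a g² + b)`, `g' = f(1 − g²)`, `f(0) = 0`, `g(0) = x`. -/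
def IsSolOn (a b x : ℝ) (f g : ℝ → ℝ) (s : Set ℝ) : Prop :=
  f 0 = 0 ∧ g 0 = x ∧ ContinuousOn f s ∧ ContinuousOn g s ∧
  ∀ r ∈ s, 0 < r →
    HasDerivAt f (g r * ((f r) ^ 2 - a * (g r) ^ 2 + b) - 2 / r * f r) r ∧
    HasDerivAt g (f r * (1 - (g r) ^ 2)) r

/-- `(f, g)` is a `C¹` solution on `s` of the regularized Cauchy problem
`f' + (2 φ(f,g)/r) f = g(f² − a g² + b)`, `g' = f(1 − g²)`, `f(0) = 0`, `g(0) = x`. -/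
def IsRegSolOn (a b : ℝ) (φ : ℝ → ℝ → ℝ) (x : ℝ) (f g : ℝ → ℝ) (s : Set ℝ) : Prop :=
  f 0 = 0 ∧ g 0 = x ∧ ContinuousOn f s ∧ ContinuousOn g s ∧
  ∀ r ∈ s, 0 < r →
    HasDerivAt f (g r * ((f r) ^ 2 - a * (g r) ^ 2 + b) - 2 * φ (f r) (g r) / r * f r) r ∧
    HasDerivAt g (f r * (1 - (g r) ^ 2)) r

/-- `(f, g)` is a solution on `s` of the autonomous (Hamiltonian) system
`f' = g(f² − a g² + b)`, `g' = f(1 − g²)` with initial data `(fi, gi)`. -/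
def IsAutSolOn (a b fi gi : ℝ) (f g : ℝ → ℝ) (s : Set ℝ) : Prop :=
  f 0 = fi ∧ g 0 = gi ∧ ContinuousOn f s ∧ ContinuousOn g s ∧
  ∀ r ∈ s,
    HasDerivAt f (g r * ((f r) ^ 2 - a * (g r) ^ 2 + b)) r ∧
    HasDerivAt g (f r * (1 - (g r) ^ 2)) r

/-- `(f, g)` is a solution on `s` of the shifted regularized system
`f' + (2 φ(f,g)/(ρ+r)) f = g(f² − a g² + b)`, `g' = f(1 − g²)` with initial data `(fi, gi)`. -/
def IsShiftSolOn (a b : ℝ) (φ : ℝ → ℝ → ℝ) (ρ fi gi : ℝ) (f g : ℝ → ℝ) (s : Set ℝ) : Prop :=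
  f 0 = fi ∧ g 0 = gi ∧ ContinuousOn f s ∧ ContinuousOn g s ∧
  ∀ r ∈ s,
    HasDerivAt f (g r * ((f r) ^ 2 - a * (g r) ^ 2 + b) - 2 * φ (f r) (g r) / (ρ + r) * f r) r ∧
    HasDerivAt g (f r * (1 - (g r) ^ 2)) r

/-- The interval `[0, R)` with possibly infinite right endpoint. -/
def edom (R : EReal) : Set ℝ := {r : ℝ | 0 ≤ r ∧ (r : EReal) < R}

/-- `g` changes sign at `r₀` relative to the interval `s`. -/
def ChangesSignAt (g : ℝ → ℝ) (s : Set ℝ) (r₀ : ℝ) : Prop :=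
  g r₀ = 0 ∧ ∃ ε > 0, Icc (r₀ - ε) (r₀ + ε) ⊆ s ∧
    g (r₀ - ε) * g (r₀ + ε) < 0 ∧ ∀ r ∈ Ioo (0 : ℝ) ε, g (r₀ - r) * g (r₀ + r) ≤ 0

/-- `g` changes sign exactly `k` times on `s`. -/
def ChangesSignExactly (g : ℝ → ℝ) (s : Set ℝ) (k : ℕ) : Prop :=
  {r | ChangesSignAt g s r}.Finite ∧ {r | ChangesSignAt g s r}.ncard = k

/-- The set `A_k`, for the family of solutions `x ↦ (F x, G x)`. -/
def Aset (a b : ℝ) (F G : ℝ → ℝ → ℝ) (k : ℕ) : Set ℝ :=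
  {x | x ∈ Ioo (0 : ℝ) 1 ∧
    (∃ L, L < 0 ∧ Tendsto (fun r => Ham a b (F x r) (G x r)) atTop (nhds L)) ∧
    ChangesSignExactly (G x) (Ioi 0) k}

/-- The set `I_k`, for the family of solutions `x ↦ (F x, G x)`. -/
def Iset (a b : ℝ) (F G : ℝ → ℝ → ℝ) (k : ℕ) : Set ℝ :=
  {x | x ∈ Ioo (0 : ℝ) 1 ∧
    Tendsto (fun r => (F x r, G x r)) atTop (nhds ((0 : ℝ), (0 : ℝ))) ∧
    ChangesSignExactly (G x) (Ioi 0) k}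

lemma pos_of_deriv_ge_neg_mul {E E' : ℝ → ℝ} {K α β : ℝ} (hαβ : α ≤ β)
    (hc : ContinuousOn E (Icc α β)) (hd : ∀ s ∈ Ioo α β, HasDerivAt E (E' s) s)
    (hE : ∀ s ∈ Ioo α β, -K * E s ≤ E' s) (h0 : 0 < E α) : 0 < E β := by
  have hmono : MonotoneOn (fun s => E s * Real.exp (K * s)) (Icc α β) := by
    refine monotoneOn_of_hasDerivWithinAt_nonneg (convex_Icc α β)
      (f' := fun s => E' s * Real.exp (K * s) + E s * (Real.exp (K * s) * K)) ?_ ?_ ?_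
    · exact hc.mul (by fun_prop)
    · intro s hs
      rw [interior_Icc] at hs
      have h1 : HasDerivAt (fun s : ℝ => Real.exp (K * s)) (Real.exp (K * s) * K) s := by
        simpa using ((hasDerivAt_id s).const_mul K).exp
      exact ((hd s hs).mul h1).hasDerivWithinAt
    · intro s hs
      rw [interior_Icc] at hs
      nlinarith [hE s hs, Real.exp_pos (K * s)]
  have h1 := hmono (left_mem_Icc.2 hαβ) (right_mem_Icc.2 hαβ) hαβ
  have h2 : 0 < E α * Real.exp (K * α) := by positivity
  exact pos_of_mul_pos_left (h2.trans_le h1) (Real.exp_pos _).le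

namespace IsRegSolOn

variable {a b η x : ℝ} {φ : ℝ → ℝ → ℝ} {f g : ℝ → ℝ}

lemma sq_lt_one (h : IsRegSolOn a b φ x f g (Ici 0)) (hx : x ^ 2 < 1) {r : ℝ} (hr : 0 ≤ r) :
    g r ^ 2 < 1 := by
  obtain ⟨-, hg0, hfc, hgc, hd⟩ := h
  have hne : ∀ t, 0 ≤ t → 0 < (1 - g t ^ 2) ^ 2 := by
    intro t ht
    have hsub : Icc 0 t ⊆ Ici (0 : ℝ) := fun s hs => hs.1
    obtain ⟨K, hK⟩ := isCompact_Icc.exists_bound_of_continuousOn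
      ((hfc.mul hgc).mono hsub)
    refine pos_of_deriv_ge_neg_mul (E := fun t => (1 - g t ^ 2) ^ 2) (K := 4 * K) ht
      (E' := fun s => -4 * (f s * g s) * (1 - g s ^ 2) ^ 2) ?_ ?_ ?_ ?_
    · exact (continuousOn_const.sub ((hgc.mono hsub).pow 2)).pow 2
    · intro s hs
      have := ((((hd s hs.1.le hs.1).2.pow 2).const_sub 1).pow 2)
      refine this.congr_deriv ?_
      simp only [Pi.pow_apply]
      push_cast
      ring
    · intro s hs
      have h1 := (abs_le.1 (hK s ⟨hs.1.le, hs.2.le⟩)).2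
      simp only [Pi.mul_apply] at h1
      nlinarith [sq_nonneg (1 - g s ^ 2)]
    · rw [hg0]; nlinarith
  by_contra! hcon
  have hcont : ContinuousOn (fun t => g t ^ 2) (Icc 0 r) :=
    (hgc.mono fun s hs => hs.1).pow 2
  obtain ⟨t, ht, hgt⟩ := intermediate_value_Icc hr hcont ⟨by rw [hg0]; exact hx.le, hcon⟩
  have := hne t ht.1
  simp only at hgt
  rw [hgt] at this
  norm_num at this

lemma hasDerivAt_ham (h : IsRegSolOn a b φ x f g (Ici 0)) {r : ℝ} (hr : 0 < r) :
    HasDerivAt (fun s => Ham a b (f s) (g s))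
      (-(2 * φ (f r) (g r) / r * (f r ^ 2 * (1 - g r ^ 2)))) r := by
  obtain ⟨hf, hg⟩ := h.2.2.2.2 r hr.le hr
  have := ((((hf.pow 2).const_mul (1 / 2)).mul ((hg.pow 2).const_sub 1)).add
    ((hg.pow 4).const_mul (a / 4))).sub ((hg.pow 2).const_mul (b / 2))
  refine this.congr_deriv ?_
  simp only [Pi.pow_apply]
  push_cast
  ring

lemma continuousOn_ham (h : IsRegSolOn a b φ x f g (Ici 0)) :
    ContinuousOn (fun s => Ham a b (f s) (g s)) (Ici 0) := by
  obtain ⟨-, -, hf, hg, -⟩ := h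
  unfold Ham
  fun_prop

lemma antitoneOn_ham (h : IsRegSolOn a b φ x f g (Ici 0)) (hx : x ^ 2 < 1)
    (hφ : IsCutoff a b η φ) : AntitoneOn (fun s => Ham a b (f s) (g s)) (Ici 0) := by
  refine antitoneOn_of_hasDerivWithinAt_nonpos (convex_Ici 0) h.continuousOn_ham
    (fun r hr => (h.hasDerivAt_ham ?_).hasDerivWithinAt) ?_
  · simpa using hr
  · intro r hr
    have hr : 0 < r := by simpa using hr
    have h1 := (hφ.1 (f r) (g r)).1
    have h2 := h.sq_lt_one hx hr.le
    have h3 : 0 ≤ 1 - g r ^ 2 := by linarith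
    have : 0 ≤ 2 * φ (f r) (g r) / r * (f r ^ 2 * (1 - g r ^ 2)) := by positivity
    linarith

lemma two_mul_sq_le (h : IsRegSolOn a b φ x f g (Ici 0)) (hx : x ^ 2 < 1)
    (hφ : IsCutoff a b η φ) (ha : 0 < a) (hab : 2 * b < a) {r : ℝ} (hr : 0 ≤ r) :
    2 * f r ^ 2 ≤ a - 2 * b + a * g r ^ 2 := by
  have h1 := h.antitoneOn_ham hx hφ (mem_Ici.2 le_rfl) hr hr
  have h2 := h.sq_lt_one hx hr
  simp only [Ham, h.1, h.2.1] at h1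
  by_contra! hcon
  have h3 : 0 < (1 - x ^ 2) * (a - 2 * b + a * x ^ 2) :=
    mul_pos (by linarith) (by nlinarith [sq_nonneg x])
  have h4 := mul_pos (sub_pos.2 hcon) (sub_pos.2 h2)
  nlinarith

lemma cutoff_eq_one (h : IsRegSolOn a b φ x f g (Ici 0)) (hx : x ^ 2 < 1)
    (hφ : IsCutoff a b η φ) (hη : η < Real.sqrt (a - b) - Real.sqrt (a / 2))
    (ha : 0 < a) (hab : 2 * b < a) {r : ℝ} (hr : 0 ≤ r) (hg : a * g r ^ 2 ≤ 2 * b) :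
    φ (f r) (g r) = 1 := by
  refine hφ.2.2.2.2 _ _ ?_
  have h1 := h.two_mul_sq_le hx hφ ha hab hr
  have : |f r| ≤ Real.sqrt (a / 2) := Real.abs_le_sqrt (by linarith)
  linarith

lemma sq_add_sq_pos (h : IsRegSolOn a b φ x f g (Ici 0)) (hx : x ^ 2 < 1) (hx0 : x ≠ 0)
    (hφ : IsCutoff a b η φ) (hb : 0 < b) (hab : 2 * b < a) {r : ℝ} (hr : 0 < r) :
    0 < f r ^ 2 + g r ^ 2 := by
  obtain ⟨-, hg0, hfc, hgc, hd⟩ := id h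
  obtain ⟨δ, hδ, hδr, hgδ⟩ : ∃ δ, 0 < δ ∧ δ < r ∧ g δ ≠ 0 := by
    have h1 : ∀ᶠ s in 𝓝[>] (0 : ℝ), g s ≠ 0 :=
      ((hgc 0 (mem_Ici.2 le_rfl)).mono Ioi_subset_Ici_self).eventually_ne (by rwa [hg0])
    obtain ⟨s, hs, hs'⟩ := (h1.and (Ioo_mem_nhdsGT hr)).exists
    exact ⟨s, hs'.1, hs'.2, hs⟩
  have hsub : Icc δ r ⊆ Ici (0 : ℝ) := fun s hs => hδ.le.trans hs.1
  refine pos_of_deriv_ge_neg_mul (E := fun t => f t ^ 2 + g t ^ 2)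
    (K := 2 * a + b + 1 + 4 / δ) hδr.le
    (E' := fun s => 2 * f s * (g s * ((f s) ^ 2 - a * (g s) ^ 2 + b)
      - 2 * φ (f s) (g s) / s * f s) + 2 * g s * (f s * (1 - (g s) ^ 2))) ?_ ?_ ?_ ?_
  · exact ((hfc.mono hsub).pow 2).add ((hgc.mono hsub).pow 2)
  · intro s hs
    have hs0 : 0 < s := hδ.trans hs.1
    obtain ⟨hf, hg⟩ := hd s hs0.le hs0
    refine ((hf.pow 2).add (hg.pow 2)).congr_deriv ?_
    push_cast
    ring
  · intro s hs
    have hs0 : 0 < s := hδ.trans hs.1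
    have h1 := h.two_mul_sq_le hx hφ (by linarith) hab hs0.le
    have h2 := h.sq_lt_one hx hs0.le
    obtain ⟨h3, h4⟩ := hφ.1 (f s) (g s)
    have h5 : 2 * φ (f s) (g s) / s ≤ 2 / δ := by
      gcongr
      · linarith
      · exact hs.1.le
    have h6 : 2 * φ (f s) (g s) / s * f s ^ 2 ≤ 2 / δ * f s ^ 2 := by gcongr
    set c := f s ^ 2 - a * g s ^ 2 + b + (1 - g s ^ 2) with hc
    have hc1 : |c| ≤ 2 * a + b + 1 := by
      rw [abs_le]; constructor <;> nlinarith [sq_nonneg (f s), sq_nonneg (g s)]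
    have h7 : |2 * f s * g s * c| ≤ (f s ^ 2 + g s ^ 2) * (2 * a + b + 1) := by
      rw [abs_mul]
      gcongr
      rw [abs_le]; constructor <;> nlinarith [sq_nonneg (f s + g s), sq_nonneg (f s - g s)]
    have h8 := (abs_le.1 h7).1
    have h9 : 0 ≤ 4 / δ * g s ^ 2 := by positivity
    have h10 : 4 / δ = 2 * (2 / δ) := by ring
    rw [h10] at h9 ⊢
    have h11 : 2 * f s * (g s * ((f s) ^ 2 - a * (g s) ^ 2 + b)
      - 2 * φ (f s) (g s) / s * f s) + 2 * g s * (f s * (1 - (g s) ^ 2))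
      = 2 * f s * g s * c - 2 * (2 * φ (f s) (g s) / s * f s ^ 2) := by rw [hc]; ring
    rw [h11]
    linarith
  · positivity

lemma changesSignAt (h : IsRegSolOn a b φ x f g (Ici 0)) (hx : x ^ 2 < 1) (hx0 : x ≠ 0)
    (hφ : IsCutoff a b η φ) (hb : 0 < b) (hab : 2 * b < a) {r : ℝ} (hr : 0 < r)
    (hg : g r = 0) {s : Set ℝ} (hs : s ∈ 𝓝 r) : ChangesSignAt g s r := by
  have hpos := h.sq_add_sq_pos hx hx0 hφ hb hab hr
  have hf : f r ≠ 0 := by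
    rintro hf
    rw [hf, hg] at hpos
    norm_num at hpos
  have hd := (h.2.2.2.2 r hr.le hr).2
  rw [hg] at hd
  have hd : HasDerivAt g (f r) r := by simpa using hd
  have hslope : Tendsto (fun t => slope g r t * f r) (𝓝[≠] r) (𝓝 (f r * f r)) :=
    (hasDerivAt_iff_tendsto_slope.1 hd).mul_const _
  have hev : ∀ᶠ t in 𝓝[≠] r, 0 < slope g r t * f r :=
    hslope.eventually_const_lt (mul_self_pos.2 hf)
  rw [eventually_nhdsWithin_iff] at hev
  obtain ⟨ε, hε, hball⟩ := Metric.eventually_nhds_iff.1 (hev.and hs)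
  have key : ∀ t ∈ Ioo 0 ε, g (r - t) * g (r + t) < 0 := by
    intro t ht
    have h1 := (hball (y := r - t) (by simp [abs_of_pos ht.1, ht.2])).1
      (by simp [ht.1.ne'])
    have h2 := (hball (y := r + t) (by simp [abs_of_pos ht.1, ht.2])).1
      (by simp [ht.1.ne'])
    have h3 : slope g r (r - t) = -(g (r - t) / t) := by
      rw [slope_def_field, hg]; rw [sub_zero, sub_sub_cancel_left, div_neg]
    have h4 : slope g r (r + t) = g (r + t) / t := by
      rw [slope_def_field, hg]; rw [sub_zero, add_sub_cancel_left]
    rw [h3] at h1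
    rw [h4] at h2
    have ht := ht.1
    have h5 : 0 < (-(g (r - t) / t) * f r) * (g (r + t) / t * f r) * t ^ 2 := by positivity
    have h6 : (-(g (r - t) / t) * f r) * (g (r + t) / t * f r) * t ^ 2
      = -(g (r - t) * g (r + t)) * (f r) ^ 2 := by field_simp
    rw [h6] at h5
    have := pos_of_mul_pos_left h5 (sq_nonneg _)
    linarith
  refine ⟨hg, ε / 2, by positivity, ?_, key _ ⟨by positivity, by linarith⟩, fun t ht =>
    (key t ⟨ht.1, by linarith [ht.2]⟩).le⟩
  intro t ht
  refine (hball ?_).2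
  rw [Real.dist_eq]
  exact (abs_le.2 ⟨by linarith [ht.1], by linarith [ht.2]⟩).trans_lt (by linarith : ε / 2 < ε)

lemma hasDerivAt_mul_ham (h : IsRegSolOn a b φ x f g (Ici 0)) (hx : x ^ 2 < 1)
    (hφ : IsCutoff a b η φ) (hη : η < Real.sqrt (a - b) - Real.sqrt (a / 2))
    (ha : 0 < a) (hab : 2 * b < a) {r : ℝ} (hr : 0 < r) (hg : a * g r ^ 2 ≤ 2 * b) :
    HasDerivAt (fun s => s * Ham a b (f s) (g s))
      (Ham a b (f r) (g r) - 2 * (f r ^ 2 * (1 - g r ^ 2))) r := by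
  have h1 := h.hasDerivAt_ham hr
  rw [h.cutoff_eq_one hx hφ hη ha hab hr.le hg] at h1
  refine ((hasDerivAt_id r).mul h1).congr_deriv ?_
  simp only [id]
  field_simp
  ring

lemma deriv_mul_ham_le (h : IsRegSolOn a b φ x f g (Ici 0)) (hx : x ^ 2 < 1) {r : ℝ}
    (hr : 0 < r) : Ham a b (f r) (g r) - 2 * (f r ^ 2 * (1 - g r ^ 2)) ≤
      -(1 / 4 * (g r ^ 2 * (2 * b - a * g r ^ 2))) := by
  have h1 := h.sq_lt_one hx hr.le
  have h2 : 0 ≤ f r ^ 2 * (1 - g r ^ 2) := mul_nonneg (sq_nonneg _) (by linarith)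
  unfold Ham
  linarith

lemma antitoneOn_mul_ham (h : IsRegSolOn a b φ x f g (Ici 0)) (hx : x ^ 2 < 1)
    (hφ : IsCutoff a b η φ) (hη : η < Real.sqrt (a - b) - Real.sqrt (a / 2))
    (ha : 0 < a) (hab : 2 * b < a) {R s : ℝ} (hR : 0 < R)
    (hg : ∀ t ∈ Icc R s, a * g t ^ 2 ≤ 2 * b) :
    AntitoneOn (fun t => t * Ham a b (f t) (g t)) (Icc R s) := by
  have hd : ∀ t ∈ Icc R s, _ := fun t ht =>
    h.hasDerivAt_mul_ham hx hφ hη ha hab (hR.trans_le ht.1) (hg t ht)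
  refine antitoneOn_of_hasDerivWithinAt_nonpos (convex_Icc R s)
    (fun t ht => (hd t ht).continuousAt.continuousWithinAt)
    (fun t ht => (hd t (interior_subset ht)).hasDerivWithinAt) ?_
  intro t ht
  have ht := interior_subset ht
  have h1 := h.deriv_mul_ham_le hx (hR.trans_le ht.1)
  have h2 := mul_nonneg (sq_nonneg (g t)) (sub_nonneg.2 (hg t ht))
  linarith

lemma antitoneOn_g (h : IsRegSolOn a b φ x f g (Ici 0)) (hx : x ^ 2 < 1) {D : Set ℝ}
    (hD : Convex ℝ D) (hD0 : D ⊆ Ioi 0) (hf : ∀ t ∈ D, f t ≤ 0) : AntitoneOn g D := by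
  have hd : ∀ t ∈ D, _ := fun t ht => (h.2.2.2.2 t (hD0 ht).out.le (hD0 ht)).2
  refine antitoneOn_of_hasDerivWithinAt_nonpos hD
    (fun t ht => (hd t ht).continuousAt.continuousWithinAt)
    (fun t ht => (hd t (interior_subset ht)).hasDerivWithinAt) ?_
  intro t ht
  have ht := interior_subset ht
  exact mul_nonpos_of_nonpos_of_nonneg (hf t ht)
    (sub_nonneg.2 (h.sq_lt_one hx (hD0 ht).out.le).le)

end IsRegSolOn

lemma sqrt_mul_trapping_const_le {a b : ℝ} (hb : 0 < b) (hab : 2 * b < a) :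
    Real.sqrt b * (Real.sqrt (2 * b / (9 * a * (a - b))) * (80 * b ^ 2 / (81 * a))) ≤
      80 / 243 * (b ^ 2 / a) := by
  have ha : 0 < a := by linarith
  have h0 : 0 < a - b := by linarith
  have h1 : Real.sqrt b * Real.sqrt (2 * b / (9 * a * (a - b))) ≤ 1 / 3 := by
    rw [← Real.sqrt_mul hb.le, Real.sqrt_le_left (by norm_num), mul_div_assoc',
      div_le_iff₀ (by positivity)]
    nlinarith
  calc _ = Real.sqrt b * Real.sqrt (2 * b / (9 * a * (a - b))) * (80 * b ^ 2 / (81 * a)) := by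
        ring
    _ ≤ 1 / 3 * (80 * b ^ 2 / (81 * a)) := by gcongr
    _ = _ := by field_simp; norm_num

lemma neg_mul_le_of_ham_nonneg {a b u v : ℝ} (ha : 0 < a) (hb : 0 < b) (hv : a * v ^ 2 ≤ 2 * b)
    (hu : u ≤ 0) (hH : 0 ≤ Ham a b u v) :
    -(v * (b - a / 2 * v ^ 2)) ≤ Real.sqrt b * -u := by
  have hw : 0 ≤ b - a / 2 * v ^ 2 := by linarith
  have h1 : v ^ 2 * (b - a / 2 * v ^ 2) ≤ u ^ 2 := by
    unfold Ham at hH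
    nlinarith [mul_nonneg (sq_nonneg u) (sq_nonneg v)]
  have h2 : 0 ≤ Real.sqrt b * -u := mul_nonneg (Real.sqrt_nonneg _) (by linarith)
  refine le_of_abs_le (abs_le_of_sq_le_sq ?_ h2)
  rw [mul_pow, Real.sq_sqrt hb.le]
  have h3 : 0 ≤ a / 2 * v ^ 2 := by positivity
  nlinarith [mul_nonneg (mul_nonneg (sq_nonneg v) hw) h3]

namespace IsRegSolOn

variable {a b η x : ℝ} {φ : ℝ → ℝ → ℝ} {f g : ℝ → ℝ}

lemma trapped_of_Ico (h : IsRegSolOn a b φ x f g (Ici 0)) (hx : x ^ 2 < 1) (hx0 : x ≠ 0)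
    (hφ : IsCutoff a b η φ) (hη : η < Real.sqrt (a - b) - Real.sqrt (a / 2))
    (hb : 0 < b) (hab : 2 * b < a) {R s : ℝ} (hR : 0 < R) (hRs : R < s)
    (hH : Ham a b (f R) (g R) <
      Real.sqrt (2 * b / (9 * a * (a - b))) * (80 * b ^ 2 / (81 * a)) / R)
    (hgR : 0 < g R) (hIco : ∀ t ∈ Ico R s, f t < 0 ∧ a * g t ^ 2 < 2 * b)
    (hHs : 0 ≤ Ham a b (f s) (g s)) :
    f s < 0 ∧ a * g s ^ 2 ≤ max (a * g R ^ 2) b := by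
  have ha : 0 < a := by linarith
  have hsub : Icc R s ⊆ Ici (0 : ℝ) := fun t ht => hR.le.trans ht.1
  have hs0 : 0 < s := hR.trans hRs
  have hfc := h.2.2.1.mono hsub
  have hgc := h.2.2.2.1.mono hsub
  rw [← closure_Ico hRs.ne] at hfc hgc
  have hf : ∀ t ∈ Icc R s, f t ≤ 0 := by
    intro t ht
    rw [← closure_Ico hRs.ne] at ht
    exact le_on_closure (fun t ht => (hIco t ht).1.le) hfc continuousOn_const ht
  have hg : ∀ t ∈ Icc R s, a * g t ^ 2 ≤ 2 * b := by
    intro t ht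
    rw [← closure_Ico hRs.ne] at ht
    exact le_on_closure (f := fun t => a * g t ^ 2) (fun t ht => (hIco t ht).2.le)
      (continuousOn_const.mul (hgc.pow 2)) continuousOn_const ht
  rw [closure_Ico hRs.ne] at hgc
  have hanti : AntitoneOn g (Icc R s) :=
    h.antitoneOn_g hx (convex_Icc R s) (fun t ht => hR.trans_le ht.1) hf
  have hH0 : ∀ t ∈ Icc R s, 0 ≤ Ham a b (f t) (g t) := fun t ht =>
    hHs.trans (h.antitoneOn_ham hx hφ (hsub ht) hs0.le ht.2)
  have hsmem : s ∈ Icc R s := ⟨hRs.le, le_rfl⟩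
  have hRmem : R ∈ Icc R s := ⟨le_rfl, hRs.le⟩
  have hbound : a * g s ^ 2 ≤ max (a * g R ^ 2) b := by
    rcases le_or_gt 0 (g s) with hgs | hgs
    · refine le_max_of_le_left ?_
      have := hanti hRmem hsmem hRs.le
      gcongr
    · refine le_max_of_le_right ?_
      obtain ⟨T, hT, hgT⟩ := intermediate_value_Icc' hRs.le hgc ⟨hgs.le, hgR.le⟩
      have hTs : Icc T s ⊆ Icc R s := Icc_subset_Icc_left hT.1
      have hQ : AntitoneOn (fun t => Real.sqrt b * (t * Ham a b (f t) (g t)) +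
          3 / 2 * (b / 2 * g t ^ 2 - a / 8 * g t ^ 4)) (Icc T s) := by
        have hd : ∀ t ∈ Icc T s, HasDerivAt (fun t => Real.sqrt b * (t * Ham a b (f t) (g t)) +
            3 / 2 * (b / 2 * g t ^ 2 - a / 8 * g t ^ 4))
            (Real.sqrt b * (Ham a b (f t) (g t) - 2 * (f t ^ 2 * (1 - g t ^ 2))) +
              3 / 2 * ((g t * (b - a / 2 * g t ^ 2)) * (f t * (1 - g t ^ 2)))) t := by
          intro t ht
          have ht := hTs ht
          have ht0 := hR.trans_le ht.1
          have h1 := h.hasDerivAt_mul_ham hx hφ hη ha hab ht0 (hg t ht)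
          have h2 := (h.2.2.2.2 t ht0.le ht0).2
          refine ((h1.const_mul (Real.sqrt b)).add ((((h2.pow 2).const_mul (b / 2)).sub
            ((h2.pow 4).const_mul (a / 8))).const_mul (3 / 2))).congr_deriv ?_
          push_cast
          ring
        refine antitoneOn_of_hasDerivWithinAt_nonpos (convex_Icc T s)
          (fun t ht => (hd t ht).continuousAt.continuousWithinAt)
          (fun t ht => (hd t (interior_subset ht)).hasDerivWithinAt) ?_
        intro t ht
        have ht := hTs (interior_subset ht)
        have h1 := neg_mul_le_of_ham_nonneg ha hb (hg t ht) (hf t ht) (hH0 t ht)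
        have h2 := h.sq_lt_one hx (hsub ht)
        have h3 : 0 ≤ -f t * (1 - g t ^ 2) :=
          mul_nonneg (by linarith [hf t ht]) (by linarith)
        have h4 := mul_le_mul_of_nonneg_right h1 h3
        have h5 := mul_nonneg (Real.sqrt_nonneg b)
          (mul_nonneg (sq_nonneg (g t)) (sub_nonneg.2 (hg t ht)))
        unfold Ham
        linarith
      have h1 := hQ ⟨le_rfl, hT.2⟩ ⟨hT.2, le_rfl⟩ hT.2
      have h2 := h.antitoneOn_mul_ham hx hφ hη ha hab hR hg hRmem hT hT.1
      simp only [hgT] at h1 h2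
      have h3 := (lt_div_iff₀ hR).1 hH
      have h4 := sqrt_mul_trapping_const_le hb hab
      have hsb := Real.sqrt_pos.2 hb
      have h5 : Real.sqrt b * (T * Ham a b (f T) 0) ≤ 80 / 243 * (b ^ 2 / a) :=
        (mul_le_mul_of_nonneg_left (h2.trans (by linarith)) hsb.le).trans h4
      have h6 : 0 ≤ Real.sqrt b * (s * Ham a b (f s) (g s)) := by positivity
      have h7 : 3 / 2 * (b / 2 * g s ^ 2 - a / 8 * g s ^ 4) ≤ 80 / 243 * (b ^ 2 / a) := by
        linarith
      have h8 : 3 / 2 * (b / 2 * (a * g s ^ 2) - 1 / 8 * (a * g s ^ 2) ^ 2) ≤ 80 / 243 * b ^ 2 := by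
        have := mul_le_mul_of_nonneg_left h7 ha.le
        have h9 : a * (80 / 243 * (b ^ 2 / a)) = 80 / 243 * b ^ 2 := by field_simp
        rw [h9] at this
        linarith
      by_contra! hcon
      nlinarith [hg s hsmem]
  refine ⟨lt_of_le_of_ne (hf s hsmem) ?_, hbound⟩
  intro hfs
  have hlt : a * g s ^ 2 < 2 * b :=
    hbound.trans_lt (max_lt (hIco R ⟨le_rfl, hRs⟩).2 (by linarith))
  have hpos := h.sq_add_sq_pos hx hx0 hφ hb hab hs0
  rw [hfs] at hpos
  simp only [Ham, hfs] at hHs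
  have : 0 < g s ^ 2 := by linarith
  nlinarith

lemma trapped (h : IsRegSolOn a b φ x f g (Ici 0)) (hx : x ^ 2 < 1) (hx0 : x ≠ 0)
    (hφ : IsCutoff a b η φ) (hη : η < Real.sqrt (a - b) - Real.sqrt (a / 2))
    (hb : 0 < b) (hab : 2 * b < a) {R r : ℝ} (hR : 0 < R) (hRr : R ≤ r)
    (hH : Ham a b (f R) (g R) <
      Real.sqrt (2 * b / (9 * a * (a - b))) * (80 * b ^ 2 / (81 * a)) / R)
    (hgR : 0 < g R) (hgR' : a * g R ^ 2 < 2 * b) (hfR : f R < 0)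
    (hHr : 0 ≤ Ham a b (f r) (g r)) :
    f r < 0 ∧ a * g r ^ 2 ≤ max (a * g R ^ 2) b := by
  have hlt : max (a * g R ^ 2) b < 2 * b := max_lt hgR' (by linarith)
  have hsub : Icc R r ⊆ Ici (0 : ℝ) := fun t ht => hR.le.trans ht.1
  have hstep : ∀ s ∈ Icc R r, (∀ t ∈ Ico R s, f t < 0 ∧ a * g t ^ 2 < 2 * b) →
      f s < 0 ∧ a * g s ^ 2 ≤ max (a * g R ^ 2) b := by
    intro s hs hIco
    rcases hs.1.eq_or_lt with rfl | hRs
    · exact ⟨hfR, le_max_left _ _⟩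
    · exact h.trapped_of_Ico hx hx0 hφ hη hb hab hR hRs hH hgR hIco
        (hHr.trans (h.antitoneOn_ham hx hφ (hsub hs) (hR.le.trans hRr) hs.2))
  by_contra hcon
  have hfc := h.2.2.1.mono hsub
  have hgc := h.2.2.2.1.mono hsub
  have hall : ∀ t ∈ Icc R r, f t < 0 ∧ a * g t ^ 2 < 2 * b := by
    by_contra! hne
    have hclosed : IsClosed (Icc R r ∩ (fun t => max (f t) (a * g t ^ 2 - 2 * b)) ⁻¹' Ici 0) :=
      ContinuousOn.preimage_isClosed_of_isClosed
        (hfc.sup ((continuousOn_const.mul (hgc.pow 2)).sub continuousOn_const)) isClosed_Icc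
        isClosed_Ici
    obtain ⟨s, ⟨hs, hbad⟩, hleast⟩ := (isCompact_Icc.of_isClosed_subset hclosed
      inter_subset_left).exists_isLeast (by
        obtain ⟨t, ht, h1⟩ := hne
        refine ⟨t, ht, ?_⟩
        rcases lt_or_ge (f t) 0 with h2 | h2
        · exact le_max_of_le_right (sub_nonneg.2 (h1 h2))
        · exact le_max_of_le_left h2)
    obtain ⟨h1, h2⟩ := hstep s hs fun t ht => by
      by_contra! h1
      have : s ≤ t := hleast ⟨⟨ht.1, ht.2.le.trans hs.2⟩, by
        rcases lt_or_ge (f t) 0 with h2 | h2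
        · exact le_max_of_le_right (sub_nonneg.2 (h1 h2))
        · exact le_max_of_le_left h2⟩
      exact ht.2.not_ge this
    have h3 : max (f s) (a * g s ^ 2 - 2 * b) < 0 := max_lt h1 (by linarith)
    exact h3.not_ge hbad
  exact hcon (hstep r ⟨hRr, le_rfl⟩ fun t ht => hall t ⟨ht.1, ht.2.le⟩)

lemma strictAntiOn_g (h : IsRegSolOn a b φ x f g (Ici 0)) (hx : x ^ 2 < 1) {D : Set ℝ}
    (hD : Convex ℝ D) (hD0 : D ⊆ Ioi 0) (hf : ∀ t ∈ D, f t < 0) : StrictAntiOn g D := by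
  have hd : ∀ t ∈ D, _ := fun t ht => (h.2.2.2.2 t (hD0 ht).out.le (hD0 ht)).2
  refine strictAntiOn_of_hasDerivWithinAt_neg hD
    (fun t ht => (hd t ht).continuousAt.continuousWithinAt)
    (fun t ht => (hd t (interior_subset ht)).hasDerivWithinAt) ?_
  intro t ht
  have ht := interior_subset ht
  exact mul_neg_of_neg_of_pos (hf t ht) (sub_pos.2 (h.sq_lt_one hx (hD0 ht).out.le))

end IsRegSolOn

lemma exists_tendsto_of_antitoneOn_Ici {u : ℝ → ℝ} {c m : ℝ} (hu : AntitoneOn u (Ici c))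
    (hm : ∀ t ∈ Ici c, m ≤ u t) : ∃ L, Tendsto u atTop (𝓝 L) := by
  have hanti : Antitone fun t => u (max t c) := fun s t hst =>
    hu (mem_Ici.2 (le_max_right _ _)) (mem_Ici.2 (le_max_right _ _)) (max_le_max_right c hst)
  refine ⟨_, (tendsto_atTop_ciInf hanti ⟨m, ?_⟩).congr' ?_⟩
  · rintro _ ⟨t, rfl⟩
    exact hm _ (mem_Ici.2 (le_max_right _ _))
  · filter_upwards [eventually_ge_atTop c] with t ht
    rw [max_eq_left ht]

namespace IsRegSolOn

variable {a b η x : ℝ} {φ : ℝ → ℝ → ℝ} {f g : ℝ → ℝ}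

lemma tendsto_zero_of_trapped (h : IsRegSolOn a b φ x f g (Ici 0)) (hx : x ^ 2 < 1)
    (hφ : IsCutoff a b η φ) (hη : η < Real.sqrt (a - b) - Real.sqrt (a / 2))
    (hb : 0 < b) (hab : 2 * b < a) {R κ : ℝ} (hR : 0 < R) (hκ : κ < 2 * b)
    (hf : ∀ t ∈ Ici R, f t < 0) (hg : ∀ t ∈ Ici R, a * g t ^ 2 ≤ κ)
    (hH : ∀ t ∈ Ici R, 0 ≤ Ham a b (f t) (g t)) :
    Tendsto f atTop (𝓝 0) ∧ Tendsto g atTop (𝓝 0) := by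
  have ha : 0 < a := by linarith
  have hR0 : Ici R ⊆ Ioi (0 : ℝ) := fun t ht => hR.trans_le ht
  obtain ⟨m, hm⟩ := exists_tendsto_of_antitoneOn_Ici (m := -1)
    (h.strictAntiOn_g hx (convex_Ici R) hR0 hf).antitoneOn (fun t ht =>
      (abs_lt.1 ((sq_lt_one_iff_abs_lt_one _).1 (h.sq_lt_one hx (hR0 ht).out.le))).1.le)
  have hm0 : m = 0 := by
    by_contra hm0
    have hm2 : 0 < m ^ 2 := by positivity
    obtain ⟨T, hT⟩ := eventually_atTop.1 ((hm.pow 2).eventually_const_lt (half_lt_self hm2))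
    set T' := max T R
    have hTR : Ici T' ⊆ Ici R := Ici_subset_Ici.2 (le_max_right _ _)
    set δ := 1 / 4 * (m ^ 2 / 2 * (2 * b - κ))
    have hδ : 0 < δ := by
      have : 0 < 2 * b - κ := by linarith
      positivity
    have hd : ∀ t ∈ Ici T', _ := fun t ht =>
      (h.hasDerivAt_mul_ham hx hφ hη ha hab (hR0 (hTR ht))
        ((hg t (hTR ht)).trans hκ.le)).add ((hasDerivAt_id t).const_mul δ)
    have hanti : AntitoneOn (fun t => t * Ham a b (f t) (g t) + δ * t) (Ici T') := by
      refine antitoneOn_of_hasDerivWithinAt_nonpos (convex_Ici T')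
        (fun t ht => (hd t ht).continuousAt.continuousWithinAt)
        (fun t ht => (hd t (interior_subset ht)).hasDerivWithinAt) ?_
      intro t ht
      have ht := interior_subset ht
      have h1 := h.deriv_mul_ham_le hx (hR0 (hTR ht))
      have h2 := hT t ((le_max_left _ _).trans ht)
      have h3 : m ^ 2 / 2 * (2 * b - κ) ≤ g t ^ 2 * (2 * b - a * g t ^ 2) :=
        mul_le_mul h2.le (by linarith [hg t (hTR ht)]) (by linarith) (sq_nonneg _)
      have h4 : δ = 1 / 4 * (m ^ 2 / 2 * (2 * b - κ)) := rfl
      linarith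
    have hT0 : 0 ≤ T' * Ham a b (f T') (g T') :=
      mul_nonneg (hR0 (hTR self_mem_Ici)).out.le (hH _ (hTR self_mem_Ici))
    set s := T' + (T' * Ham a b (f T') (g T') / δ + 1) with hs
    have hsT : T' ≤ s := by
      have : 0 ≤ T' * Ham a b (f T') (g T') / δ := by positivity
      linarith
    have h1 := hanti self_mem_Ici hsT hsT
    have h2 : 0 ≤ s * Ham a b (f s) (g s) :=
      mul_nonneg (hR0 (hTR hsT)).out.le (hH _ (hTR hsT))
    have h3 : δ * s = δ * T' + T' * Ham a b (f T') (g T') + δ := by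
      rw [hs]; field_simp; ring
    simp only at h1
    linarith
  subst hm0
  refine ⟨?_, hm⟩
  have hHlim : Tendsto (fun t => Ham a b (f t) (g t)) atTop (𝓝 0) := by
    refine squeeze_zero' (g := fun t => R * Ham a b (f R) (g R) / t) ?_ ?_
      (tendsto_const_nhds.div_atTop tendsto_id)
    · filter_upwards [eventually_ge_atTop R] with t ht using hH t ht
    · filter_upwards [eventually_ge_atTop R] with t ht
      rw [le_div_iff₀ (hR.trans_le ht), mul_comm]
      exact h.antitoneOn_mul_ham hx hφ hη ha hab hR
        (fun s hs => (hg s hs.1).trans hκ.le) ⟨le_rfl, ht⟩ ⟨ht, le_rfl⟩ ht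
  have hsq : Tendsto (fun t => f t ^ 2) atTop (𝓝 0) := by
    have h1 : Tendsto (fun t => (2 * Ham a b (f t) (g t) - a / 2 * g t ^ 4 + b * g t ^ 2) /
        (1 - g t ^ 2)) atTop (𝓝 ((2 * 0 - a / 2 * 0 ^ 4 + b * 0 ^ 2) / (1 - 0 ^ 2))) :=
      (((hHlim.const_mul 2).sub ((hm.pow 4).const_mul _)).add ((hm.pow 2).const_mul _)).div
        ((hm.pow 2).const_sub 1) (by norm_num)
    norm_num at h1
    refine h1.congr' ?_
    filter_upwards [eventually_ge_atTop R] with t ht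
    have h2 : 1 - g t ^ 2 ≠ 0 := (sub_pos.2 (h.sq_lt_one hx (hR0 ht).out.le)).ne'
    rw [div_eq_iff h2, Ham]
    ring
  rw [tendsto_zero_iff_abs_tendsto_zero]
  have := hsq.sqrt
  rw [Real.sqrt_zero] at this
  exact this.congr fun t => Real.sqrt_sq_eq_abs _

lemma trapping_alternative (h : IsRegSolOn a b φ x f g (Ici 0)) (hx : x ^ 2 < 1) (hx0 : x ≠ 0)
    (hφ : IsCutoff a b η φ) (hη : η < Real.sqrt (a - b) - Real.sqrt (a / 2))
    (hb : 0 < b) (hab : 2 * b < a) {R : ℝ} (hR : 0 < R)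
    (hH : Ham a b (f R) (g R) <
      Real.sqrt (2 * b / (9 * a * (a - b))) * (80 * b ^ 2 / (81 * a)) / R)
    (hgR : g R ∈ Ioo 0 (Real.sqrt (2 * b / a))) (hfR : f R < 0) :
    ({r | R ≤ r ∧ g r = 0}.Subsingleton ∧
      ∃ L, L < 0 ∧ Tendsto (fun r => Ham a b (f r) (g r)) atTop (𝓝 L)) ∨
    ({r | R ≤ r ∧ g r = 0} = ∅ ∧ Tendsto f atTop (𝓝 0) ∧ Tendsto g atTop (𝓝 0)) := by
  have ha : 0 < a := by linarith
  have hR0 : Ici R ⊆ Ioi (0 : ℝ) := fun t ht => hR.trans_le ht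
  have hgR' : a * g R ^ 2 < 2 * b := by
    have := (Real.lt_sqrt hgR.1.le).1 hgR.2
    rw [lt_div_iff₀ ha] at this
    linarith
  have htrap : ∀ r ∈ Ici R, 0 ≤ Ham a b (f r) (g r) →
      f r < 0 ∧ a * g r ^ 2 ≤ max (a * g R ^ 2) b := fun r hr hHr =>
    h.trapped hx hx0 hφ hη hb hab hR hr hH hgR.1 hgR' hfR hHr
  have hanti := h.antitoneOn_ham hx hφ
  by_cases hall : ∀ r ∈ Ici R, 0 ≤ Ham a b (f r) (g r)
  · right
    have hf : ∀ r ∈ Ici R, f r < 0 := fun r hr => (htrap r hr (hall r hr)).1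
    have hlim := h.tendsto_zero_of_trapped hx hφ hη hb hab hR
      (max_lt hgR' (by linarith)) hf (fun r hr => (htrap r hr (hall r hr)).2) hall
    refine ⟨?_, hlim⟩
    have hgs := h.strictAntiOn_g hx (convex_Ici R) hR0 hf
    ext r
    simp only [mem_ofPred_eq, mem_empty_iff_false, iff_false, not_and]
    intro hr hgr
    have hr1 : R ≤ r + 1 := by linarith
    have h1 : g (r + 1) < 0 := hgr ▸ hgs hr hr1 (lt_add_one r)
    have h2 : (0 : ℝ) ≤ g (r + 1) := by
      refine le_of_tendsto hlim.2 ?_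
      filter_upwards [eventually_ge_atTop (r + 1)] with t ht
      exact hgs.antitoneOn hr1 (hr1.trans ht) ht
    exact h1.not_ge h2
  · left
    push Not at hall
    obtain ⟨r₁, hr₁, hneg⟩ := hall
    refine ⟨?_, ?_⟩
    · have key : ∀ s t, R ≤ s → s < t → g s = 0 → g t = 0 → False := by
        intro s t hs hst hgs hgt
        have hsub : Icc s t ⊆ Ici R := fun u hu => hs.trans hu.1
        have hHt : 0 ≤ Ham a b (f t) (g t) := by
          rw [hgt, Ham]; nlinarith [sq_nonneg (f t)]
        have hg := h.strictAntiOn_g hx (convex_Icc s t) (hsub.trans hR0) fun u hu =>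
          (htrap u (hsub hu) (hHt.trans (hanti (hR0 (hsub hu)).out.le
            (hR0 (hs.trans hst.le)).out.le hu.2))).1
        have := hg ⟨le_rfl, hst.le⟩ ⟨hst.le, le_rfl⟩ hst
        rw [hgs, hgt] at this
        exact this.false
      rintro s ⟨hs, hgs⟩ t ⟨ht, hgt⟩
      rcases lt_trichotomy s t with hst | hst | hst
      · exact (key s t hs hst hgs hgt).elim
      · exact hst
      · exact (key t s ht hst hgt hgs).elim
    · obtain ⟨L, hL⟩ := exists_tendsto_of_antitoneOn_Ici (m := -(b / 2)) hanti fun t ht => by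
        have h1 := h.sq_lt_one hx ht
        have h2 := mul_nonneg (sq_nonneg (f t)) (sub_nonneg.2 h1.le)
        have h3 : 0 ≤ a / 4 * g t ^ 4 := by positivity
        simp only [Ham]
        nlinarith
      refine ⟨L, lt_of_le_of_lt (le_of_tendsto hL ?_) hneg, hL⟩
      filter_upwards [eventually_ge_atTop r₁] with t ht
      exact hanti (hR0 hr₁).out.le (hR0 (hr₁.out.trans ht)).out.le ht

lemma neg (h : IsRegSolOn a b φ x f g (Ici 0)) (hφ : IsCutoff a b η φ) :
    IsRegSolOn a b φ (-x) (fun r => -f r) (fun r => -g r) (Ici 0) := by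
  obtain ⟨hf0, hg0, hfc, hgc, hd⟩ := h
  refine ⟨by simp [hf0], by simp [hg0], hfc.neg, hgc.neg, fun r hr hr0 => ?_⟩
  obtain ⟨hf, hg⟩ := hd r hr hr0
  have hφneg : φ (-f r) (-g r) = φ (f r) (g r) := by
    rw [hφ.2.2.1, abs_neg, abs_neg, ← hφ.2.2.1]
  rw [hφneg]
  exact ⟨hf.neg.congr_deriv (by ring), hg.neg.congr_deriv (by ring)⟩

lemma setOf_changesSignAt_Ioc (h : IsRegSolOn a b φ x f g (Ici 0)) (hx : x ^ 2 < 1)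
    (hx0 : x ≠ 0) (hφ : IsCutoff a b η φ) (hb : 0 < b) (hab : 2 * b < a) (R : ℝ) :
    {r | ChangesSignAt g (Ioc 0 R) r} = {r | r ∈ Ioo 0 R ∧ g r = 0} := by
  ext r
  constructor
  · rintro ⟨hg, ε, hε, hsub, -⟩
    have h1 := hsub (⟨by linarith, by linarith⟩ : r - ε ∈ Icc (r - ε) (r + ε))
    have h2 := hsub (⟨by linarith, by linarith⟩ : r + ε ∈ Icc (r - ε) (r + ε))
    exact ⟨⟨by linarith [h1.1], by linarith [h2.2]⟩, hg⟩
  · rintro ⟨hr, hg⟩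
    exact h.changesSignAt hx hx0 hφ hb hab hr.1 hg (Ioc_mem_nhds hr.1 hr.2)

lemma setOf_changesSignAt_Ioi (h : IsRegSolOn a b φ x f g (Ici 0)) (hx : x ^ 2 < 1)
    (hx0 : x ≠ 0) (hφ : IsCutoff a b η φ) (hb : 0 < b) (hab : 2 * b < a) {R : ℝ} (hR : 0 < R) :
    {r | ChangesSignAt g (Ioi 0) r} =
      {r | ChangesSignAt g (Ioc 0 R) r} ∪ {r | R ≤ r ∧ g r = 0} := by
  rw [h.setOf_changesSignAt_Ioc hx hx0 hφ hb hab]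
  ext r
  constructor
  · rintro ⟨hg, ε, hε, hsub, -⟩
    have h1 := hsub (⟨by linarith, by linarith⟩ : r ∈ Icc (r - ε) (r + ε))
    rcases lt_or_ge r R with hr | hr
    · exact Or.inl ⟨⟨h1, hr⟩, hg⟩
    · exact Or.inr ⟨hr, hg⟩
  · intro hr
    have hr' : 0 < r ∧ g r = 0 := by
      rcases hr with hr | hr
      · exact ⟨hr.1.1, hr.2⟩
      · exact ⟨hR.trans_le hr.1, hr.2⟩
    exact h.changesSignAt hx hx0 hφ hb hab hr'.1 hr'.2 (Ioi_mem_nhds hr'.1)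

lemma changesSignExactly_Ioi (h : IsRegSolOn a b φ x f g (Ici 0)) (hx : x ^ 2 < 1)
    (hx0 : x ≠ 0) (hφ : IsCutoff a b η φ) (hb : 0 < b) (hab : 2 * b < a) {R : ℝ} (hR : 0 < R)
    {k : ℕ} (hk : ChangesSignExactly g (Ioc 0 R) k)
    (hsub : {r | R ≤ r ∧ g r = 0}.Subsingleton) :
    ChangesSignExactly g (Ioi 0) (k + {r | R ≤ r ∧ g r = 0}.ncard) := by
  unfold ChangesSignExactly
  rw [h.setOf_changesSignAt_Ioi hx hx0 hφ hb hab hR]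
  refine ⟨hk.1.union hsub.finite, ?_⟩
  rw [ncard_union_eq ?_ hk.1 hsub.finite, hk.2]
  rw [h.setOf_changesSignAt_Ioc hx hx0 hφ hb hab]
  exact disjoint_left.2 fun r hr hr' => hr.1.2.not_ge hr'.1

end IsRegSolOn

/-- Lemma 3.2: the trapping lemma. -/
theorem trapping_lemma (a b η : ℝ) (hb : 0 < b) (hab : 2 * b < a)
    (hη : η ∈ Ioo 0 (Real.sqrt (a - b) - Real.sqrt (a / 2)))
    (φ : ℝ → ℝ → ℝ) (hφ : IsCutoff a b η φ)
    (F G : ℝ → ℝ → ℝ)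
    (hFG : ∀ y ∈ Ioo (0 : ℝ) 1, IsRegSolOn a b φ y (F y) (G y) (Ici 0))
    (x R : ℝ) (hx : x ∈ Ioo (0 : ℝ) 1) (hR : 0 < R) (k : ℕ)
    (hH : Ham a b (F x R) (G x R) <
      Real.sqrt (2 * b / (9 * a * (a - b))) * (80 * b ^ 2 / (81 * a)) / R)
    (hpos : (G x R ∈ Ioo 0 (Real.sqrt (2 * b / a)) ∧ F x R < 0) ∨
            (G x R ∈ Ioo (-Real.sqrt (2 * b / a)) 0 ∧ 0 < F x R))
    (hsign : ChangesSignExactly (G x) (Ioc 0 R) k) :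
    x ∈ Aset a b F G k ∪ Iset a b F G k ∪ Aset a b F G (k + 1) := by
  have hx2 : x ^ 2 < 1 := by nlinarith [hx.1, hx.2]
  have h := hFG x hx
  have key : ({r | R ≤ r ∧ G x r = 0}.Subsingleton ∧
      ∃ L, L < 0 ∧ Tendsto (fun r => Ham a b (F x r) (G x r)) atTop (𝓝 L)) ∨
      ({r | R ≤ r ∧ G x r = 0} = ∅ ∧ Tendsto (F x) atTop (𝓝 0) ∧ Tendsto (G x) atTop (𝓝 0)) := by
    rcases hpos with ⟨hg, hf⟩ | ⟨hg, hf⟩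
    · exact h.trapping_alternative hx2 hx.1.ne' hφ hη.2 hb hab hR hH hg hf
    · have hHneg : ∀ r, Ham a b (-F x r) (-G x r) = Ham a b (F x r) (G x r) := fun r => by
        simp only [Ham]; ring
      have := (h.neg hφ).trapping_alternative (by rwa [neg_sq]) (neg_ne_zero.2 hx.1.ne') hφ hη.2
        hb hab hR (by rwa [hHneg]) ⟨neg_pos.2 hg.2, neg_lt.2 hg.1⟩ (neg_neg_iff_pos.2 hf)
      simp only [hHneg, neg_eq_zero] at this
      refine this.imp_right fun ⟨h1, h2, h3⟩ => ⟨h1, ?_, ?_⟩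
      · simpa using h2.neg
      · simpa using h3.neg
  rcases key with ⟨hsub, hL⟩ | ⟨hempty, hf, hg⟩
  · have hcount := h.changesSignExactly_Ioi hx2 hx.1.ne' hφ hb hab hR hsign hsub
    rcases hsub.eq_empty_or_singleton with h0 | ⟨T, hT⟩
    · rw [h0, ncard_empty, add_zero] at hcount
      exact Or.inl (Or.inl ⟨hx, hL, hcount⟩)
    · rw [hT, ncard_singleton] at hcount
      exact Or.inr ⟨hx, hL, hcount⟩
  · have hcount := h.changesSignExactly_Ioi hx2 hx.1.ne' hφ hb hab hR hsign
      (hempty ▸ subsingleton_empty)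
    rw [hempty, ncard_empty, add_zero] at hcount
    exact Or.inl (Or.inr ⟨hx, hf.prodMk_nhds hg, hcount⟩)
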